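/- arXiv:2505.13150 — 4 statements merged into one kernel-verified Lean document; each statement's English description precedes it below -/
import Mathlib

section
/- Let S and A be nonempty finite sets, P : S → A → S → ℝ a transition function with P s a s' ≥ 0 and ∑_{s'} P s a s' = 1 for every (s,a), γ ∈ [0,1), r : S → ℝ a state reward with |r(s)| ≤ R for all s, and ρ : S → ℝ strictly positive with ∑_s ρ(s) = 1. Let D*, D̂ : S → A → S → ℝ satisfy sqrt(∑_{s⁺} ρ(s⁺)·(D̂(s,a,s⁺) − D*(s,a,s⁺))²) ≤ Δ for every (s,a). Define Q̂(s,a) := ∑_{s⁺} ρ(s⁺)·D̂(s,a,s⁺)·r(s⁺) and let π : S → A be greedy with respect to Q̂, i.e. Q̂(s, π(s)) = max_{a} Q̂(s,a) for all s. If for every (s,a) one has sqrt(∑_{s⁺} ρ(s⁺)·(D*(s,a,s⁺) − M^π(s,a,s⁺)/ρ(s⁺))²) ≤ ε*, then for every probability weight function ρ_test : S × A → ℝ (ρ_test ≥ 0, ∑ ρ_test = 1), ∑_{(s,a)} ρ_test(s,a)·(Q*_r(s,a) − Q^π_r(s,a)) ≤ (3/(1−γ))·R·(ε* + Δ). -/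
open scoped BigOperators

/-- State–action transition matrix induced by policy `π`:
`P_π((s,a),(s',a')) = P s a s'` if `a' = π s'`, else `0`. -/
noncomputable def policyMatrix {S A : Type*} [Fintype S] [Fintype A] [DecidableEq A]
    (P : S → A → S → ℝ) (π : S → A) : Matrix (S × A) (S × A) ℝ :=
  fun p q => if q.2 = π q.1 then P p.1 p.2 q.1 else 0

/-- Successor measure `M^π(s,a,sp) = ∑_{t≥0} γ^t ∑_{ap} (P_π^{t+1})((s,a),(sp,ap))`. -/
noncomputable def succMeas {S A : Type*} [Fintype S] [Fintype A] [DecidableEq S] [DecidableEq A]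
    (P : S → A → S → ℝ) (γ : ℝ) (π : S → A) (s : S) (a : A) (sp : S) : ℝ :=
  ∑' t : ℕ, γ ^ t * ∑ ap : A, (policyMatrix P π ^ (t + 1)) (s, a) (sp, ap)

/-- Q-function of policy `π` for state reward `r`. -/
noncomputable def Qpol {S A : Type*} [Fintype S] [Fintype A] [DecidableEq S] [DecidableEq A]
    (P : S → A → S → ℝ) (γ : ℝ) (r : S → ℝ) (π : S → A) (s : S) (a : A) : ℝ :=
  ∑ sp : S, r sp * succMeas P γ π s a sp

/-- Optimal Q-function: maximum over deterministic policies. -/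
noncomputable def Qopt {S A : Type*} [Fintype S] [Fintype A] [DecidableEq S] [DecidableEq A]
    (P : S → A → S → ℝ) (γ : ℝ) (r : S → ℝ) (s : S) (a : A) : ℝ :=
  ⨆ π : S → A, Qpol P γ r π s a

theorem sum_policyMatrix_mul {S A : Type*} [Fintype S] [Fintype A] [DecidableEq A]
    (P : S → A → S → ℝ) (π : S → A) (p : S × A) (f : S × A → ℝ) :
    ∑ q, policyMatrix P π p q * f q = ∑ s', P p.1 p.2 s' * f (s', π s') := by
  rw [Fintype.sum_prod_type]
  refine Finset.sum_congr rfl fun s' _ => ?_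
  simp [policyMatrix, ite_mul]

/-- The probability of being in state `sp` after `t + 1` steps from `(s, a)` under `π`. -/
noncomputable def stateOccupancy {S A : Type*} [Fintype S] [Fintype A] [DecidableEq S]
    [DecidableEq A] (P : S → A → S → ℝ) (π : S → A) (t : ℕ) (s : S) (a : A) (sp : S) : ℝ :=
  ∑ ap : A, (policyMatrix P π ^ (t + 1)) (s, a) (sp, ap)

section

variable {S A : Type*} [Fintype S] [Fintype A] [DecidableEq S] [DecidableEq A]
  (P : S → A → S → ℝ) (π : S → A)

theorem stateOccupancy_zero (s : S) (a : A) (sp : S) :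
    stateOccupancy P π 0 s a sp = P s a sp := by
  simp [stateOccupancy, policyMatrix]

theorem stateOccupancy_succ (t : ℕ) (s : S) (a : A) (sp : S) :
    stateOccupancy P π (t + 1) s a sp =
      ∑ s', P s a s' * stateOccupancy P π t s' (π s') sp := by
  have h (ap : A) : (policyMatrix P π ^ (t + 1 + 1)) (s, a) (sp, ap) =
      ∑ s', P s a s' * (policyMatrix P π ^ (t + 1)) (s', π s') (sp, ap) := by
    rw [pow_succ' _ (t + 1), Matrix.mul_apply]
    exact sum_policyMatrix_mul P π (s, a) fun q => (policyMatrix P π ^ (t + 1)) q (sp, ap)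
  simp only [stateOccupancy, h, Finset.mul_sum]
  exact Finset.sum_comm

variable {P}

theorem stateOccupancy_mem_Icc (hP0 : ∀ s a s', 0 ≤ P s a s')
    (hP1 : ∀ s a, ∑ s' : S, P s a s' = 1) (t : ℕ) (s : S) (a : A) (sp : S) :
    stateOccupancy P π t s a sp ∈ Set.Icc 0 1 := by
  induction t generalizing s a with
  | zero =>
    rw [stateOccupancy_zero]
    refine ⟨hP0 s a sp, ?_⟩
    rw [← hP1 s a]
    exact Finset.single_le_sum (fun i _ => hP0 s a i) (Finset.mem_univ sp)
  | succ t ih =>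
    rw [stateOccupancy_succ]
    refine ⟨Finset.sum_nonneg fun s' _ => mul_nonneg (hP0 s a s') (ih s' (π s')).1, ?_⟩
    rw [← hP1 s a]
    exact Finset.sum_le_sum fun s' _ =>
      mul_le_of_le_one_right (hP0 s a s') (ih s' (π s')).2

theorem summable_stateOccupancy (hP0 : ∀ s a s', 0 ≤ P s a s')
    (hP1 : ∀ s a, ∑ s' : S, P s a s' = 1) {γ : ℝ} (hγ0 : 0 ≤ γ) (hγ1 : γ < 1)
    (s : S) (a : A) (sp : S) :
    Summable fun t : ℕ => γ ^ t * stateOccupancy P π t s a sp :=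
  Summable.of_nonneg_of_le
    (fun t => mul_nonneg (pow_nonneg hγ0 t) (stateOccupancy_mem_Icc π hP0 hP1 t s a sp).1)
    (fun t => mul_le_of_le_one_right (pow_nonneg hγ0 t)
      (stateOccupancy_mem_Icc π hP0 hP1 t s a sp).2)
    (summable_geometric_of_lt_one hγ0 hγ1)

theorem succMeas_bellman (hP0 : ∀ s a s', 0 ≤ P s a s')
    (hP1 : ∀ s a, ∑ s' : S, P s a s' = 1) {γ : ℝ} (hγ0 : 0 ≤ γ) (hγ1 : γ < 1)
    (s : S) (a : A) (sp : S) :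
    succMeas P γ π s a sp =
      P s a sp + γ * ∑ s', P s a s' * succMeas P γ π s' (π s') sp := by
  have hdef (s : S) (a : A) : succMeas P γ π s a sp =
      ∑' t : ℕ, γ ^ t * stateOccupancy P π t s a sp := rfl
  have hsum := summable_stateOccupancy π hP0 hP1 hγ0 hγ1
  simp only [hdef]
  rw [(hsum s a sp).tsum_eq_zero_add, stateOccupancy_zero, pow_zero, one_mul]
  congr 1
  simp only [← tsum_mul_left]
  rw [← Summable.tsum_finsetSum fun s' _ => (hsum s' (π s') sp).mul_left _, ← tsum_mul_left]
  refine tsum_congr fun t => ?_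
  rw [stateOccupancy_succ, Finset.mul_sum, Finset.mul_sum]
  exact Finset.sum_congr rfl fun s' _ => by ring

theorem Qpol_bellman (hP0 : ∀ s a s', 0 ≤ P s a s')
    (hP1 : ∀ s a, ∑ s' : S, P s a s' = 1) {γ : ℝ} (hγ0 : 0 ≤ γ) (hγ1 : γ < 1)
    (r : S → ℝ) (s : S) (a : A) :
    Qpol P γ r π s a =
      ∑ s', P s a s' * r s' + γ * ∑ s', P s a s' * Qpol P γ r π s' (π s') := by
  unfold Qpol
  simp only [succMeas_bellman π hP0 hP1 hγ0 hγ1 s a, mul_add, Finset.sum_add_distrib]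
  congr 1
  · exact Finset.sum_congr rfl fun s' _ => mul_comm _ _
  · simp only [Finset.mul_sum]
    rw [Finset.sum_comm]
    exact Finset.sum_congr rfl fun s' _ => Finset.sum_congr rfl fun sp _ => by ring

/-- If no action improves on `π` by more than `η` in one step, then no policy improves on `π` by
more than `γ η / (1 - γ)`. -/
theorem Qpol_sub_Qpol_le [Nonempty S] [Nonempty A] (hP0 : ∀ s a s', 0 ≤ P s a s')
    (hP1 : ∀ s a, ∑ s' : S, P s a s' = 1) {γ : ℝ} (hγ0 : 0 ≤ γ) (hγ1 : γ < 1)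
    (r : S → ℝ) {η : ℝ} (hη : ∀ s a, Qpol P γ r π s a ≤ Qpol P γ r π s (π s) + η)
    (π' : S → A) (s : S) (a : A) :
    Qpol P γ r π' s a - Qpol P γ r π s a ≤ γ * η / (1 - γ) := by
  obtain ⟨p, hp⟩ := Finite.exists_max
    fun p : S × A => Qpol P γ r π' p.1 p.2 - Qpol P γ r π p.1 p.2
  set d := Qpol P γ r π' p.1 p.2 - Qpol P γ r π p.1 p.2 with hd
  have hstep : d ≤ γ * (d + η) := by
    calc d = γ * ∑ s', P p.1 p.2 s' *
            (Qpol P γ r π' s' (π' s') - Qpol P γ r π s' (π s')) := by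
          rw [hd, Qpol_bellman π' hP0 hP1 hγ0 hγ1 r p.1 p.2,
            Qpol_bellman π hP0 hP1 hγ0 hγ1 r p.1 p.2]
          simp only [mul_sub, Finset.sum_sub_distrib]
          ring
      _ ≤ γ * ∑ s', P p.1 p.2 s' * (d + η) := by
          gcongr with s' _
          · exact hP0 _ _ _
          · linarith [hp (s', π' s'), hη s' (π' s')]
      _ = γ * (d + η) := by rw [← Finset.sum_mul, hP1, one_mul]
  refine (hp (s, a)).trans ?_
  rw [le_div_iff₀ (sub_pos.mpr hγ1)]
  linarith

end

theorem abs_sum_mul_mul_le_sqrt {ι : Type*} [Fintype ι] {ρ f r : ι → ℝ} {R : ℝ}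
    (hρ : ∀ i, 0 ≤ ρ i) (hρ1 : ∑ i, ρ i = 1) (hR : 0 ≤ R) (hr : ∀ i, |r i| ≤ R) :
    |∑ i, ρ i * f i * r i| ≤ R * Real.sqrt (∑ i, ρ i * f i ^ 2) := by
  have hmean : ∑ i, ρ i * |f i| ≤ Real.sqrt (∑ i, ρ i * f i ^ 2) := by
    refine Real.le_sqrt_of_sq_le ?_
    simpa only [sq_abs, smul_eq_mul] using (even_two.convexOn_pow (𝕜 := ℝ)).map_sum_le
      (fun i _ => hρ i) hρ1 fun i _ => Set.mem_univ |f i|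
  calc |∑ i, ρ i * f i * r i| ≤ ∑ i, |ρ i * f i * r i| := Finset.abs_sum_le_sum_abs _ _
    _ ≤ ∑ i, R * (ρ i * |f i|) := by
        refine Finset.sum_le_sum fun i _ => ?_
        rw [abs_mul, abs_mul, abs_of_nonneg (hρ i), mul_comm]
        exact mul_le_mul_of_nonneg_right (hr i) (mul_nonneg (hρ i) (abs_nonneg _))
    _ = R * ∑ i, ρ i * |f i| := by rw [Finset.mul_sum]
    _ ≤ _ := mul_le_mul_of_nonneg_left hmean hR

theorem regret_bound_via_uniform_successor_approximation
    {S A : Type*} [Fintype S] [Fintype A] [Nonempty S] [Nonempty A]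
    [DecidableEq S] [DecidableEq A]
    (P : S → A → S → ℝ) (hP0 : ∀ s a s', 0 ≤ P s a s')
    (hP1 : ∀ s a, ∑ s' : S, P s a s' = 1)
    (γ : ℝ) (hγ0 : 0 ≤ γ) (hγ1 : γ < 1)
    (r : S → ℝ) (R : ℝ) (hr : ∀ s, |r s| ≤ R)
    (ρ : S → ℝ) (hρ : ∀ s, 0 < ρ s) (hρ1 : ∑ s : S, ρ s = 1)
    (Dstar Dhat : S → A → S → ℝ) (Δ : ℝ)
    (hΔ : ∀ s a,
      Real.sqrt (∑ sp : S, ρ sp * (Dhat s a sp - Dstar s a sp) ^ 2) ≤ Δ)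
    (Qhat : S → A → ℝ)
    (hQhat : ∀ s a, Qhat s a = ∑ sp : S, ρ sp * Dhat s a sp * r sp)
    (π : S → A) (hπ : ∀ s, Qhat s (π s) = ⨆ a : A, Qhat s a)
    (εstar : ℝ)
    (hε : ∀ s a, Real.sqrt (∑ sp : S, ρ sp *
      (Dstar s a sp - succMeas P γ π s a sp / ρ sp) ^ 2) ≤ εstar)
    (ρtest : S × A → ℝ) (hρt0 : ∀ p, 0 ≤ ρtest p) (hρt1 : ∑ p : S × A, ρtest p = 1) :
    ∑ p : S × A, ρtest p * (Qopt P γ r p.1 p.2 - Qpol P γ r π p.1 p.2) ≤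
      3 / (1 - γ) * R * (εstar + Δ) := by
  obtain ⟨s₀⟩ := ‹Nonempty S›
  obtain ⟨a₀⟩ := ‹Nonempty A›
  have : Nonempty S := ⟨s₀⟩
  have : Nonempty A := ⟨a₀⟩
  have hR : 0 ≤ R := (abs_nonneg _).trans (hr s₀)
  have hΔ0 : 0 ≤ Δ := (Real.sqrt_nonneg _).trans (hΔ s₀ a₀)
  have hε0 : 0 ≤ εstar := (Real.sqrt_nonneg _).trans (hε s₀ a₀)
  have hδ0 : 0 ≤ R * (εstar + Δ) := by positivity
  have hbound (f : S → ℝ) := abs_sum_mul_mul_le_sqrt (f := f) (fun s => (hρ s).le) hρ1 hR hr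
  have hclose (s : S) (a : A) : |Qhat s a - Qpol P γ r π s a| ≤ R * (εstar + Δ) := by
    have hsplit : Qhat s a - Qpol P γ r π s a =
        ∑ sp, ρ sp * (Dstar s a sp - succMeas P γ π s a sp / ρ sp) * r sp +
          ∑ sp, ρ sp * (Dhat s a sp - Dstar s a sp) * r sp := by
      rw [hQhat, Qpol, ← Finset.sum_sub_distrib, ← Finset.sum_add_distrib]
      refine Finset.sum_congr rfl fun sp _ => ?_
      have := (hρ sp).ne'
      field_simp
      ring
    rw [hsplit, mul_add]
    exact (abs_add_le _ _).trans (add_le_add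
      ((hbound _).trans (mul_le_mul_of_nonneg_left (hε s a) hR))
      ((hbound _).trans (mul_le_mul_of_nonneg_left (hΔ s a) hR)))
  have hgreedy (s : S) (a : A) :
      Qpol P γ r π s a ≤ Qpol P γ r π s (π s) + 2 * (R * (εstar + Δ)) := by
    have hmax : Qhat s a ≤ Qhat s (π s) := by
      rw [hπ s]
      exact le_ciSup (Set.finite_range _).bddAbove a
    linarith [(abs_le.mp (hclose s a)).1, (abs_le.mp (hclose s (π s))).2]
  have hregret (p : S × A) : Qopt P γ r p.1 p.2 - Qpol P γ r π p.1 p.2 ≤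
      3 / (1 - γ) * R * (εstar + Δ) := by
    have hopt : Qopt P γ r p.1 p.2 ≤
        Qpol P γ r π p.1 p.2 + γ * (2 * (R * (εstar + Δ))) / (1 - γ) :=
      ciSup_le fun π' => by
        linarith [Qpol_sub_Qpol_le π hP0 hP1 hγ0 hγ1 r hgreedy π' p.1 p.2]
    have hcoef : γ * (2 * (R * (εstar + Δ))) / (1 - γ) ≤ 3 / (1 - γ) * R * (εstar + Δ) := by
      rw [mul_assoc, div_mul_eq_mul_div]
      refine div_le_div_of_nonneg_right ?_ (sub_pos.mpr hγ1).le
      nlinarith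
    linarith
  calc _ ≤ ∑ p : S × A, ρtest p * (3 / (1 - γ) * R * (εstar + Δ)) :=
        Finset.sum_le_sum fun p _ => mul_le_mul_of_nonneg_left (hregret p) (hρt0 p)
    _ = _ := by rw [← Finset.sum_mul, hρt1, one_mul]
end

section
/- Let I be a nonempty finite index set, L ≥ 1, and let blk : I → Fin L assign each index to a block, with every block nonempty (blk is surjective). Let X : Fin L → Type be a family of nonempty types and, for each i ∈ I, let f_i : X (blk i) → ℝ with f_i ≥ 0. Then the infimum over x ∈ Π_{j} X_j of max_{i ∈ I} f_i (x (blk i)) equals max over j ∈ Fin L of the infimum over x_j ∈ X_j of max_{i : blk i = j} f_i(x_j). -/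
theorem iInf_pi_iSup_eq_iSup_iInf {ι α : Type*} [Finite ι] [Nonempty ι]
    [ConditionallyCompleteLinearOrder α] [DenselyOrdered α]
    {X : ι → Type*} [∀ j, Nonempty (X j)] (F : (j : ι) → X j → α)
    (hF : ∀ j, BddBelow (Set.range (F j))) :
    (⨅ x : (j : ι) → X j, ⨆ j, F j (x j)) = ⨆ j, ⨅ y, F j y := by
  apply le_antisymm
  · refine le_of_forall_gt_imp_ge_of_dense fun c hc => ?_
    have hlt (j : ι) : ∃ y, F j y < c :=
      exists_lt_of_ciInf_lt
        ((le_ciSup (f := fun j => ⨅ y, F j y) (Set.finite_range _).bddAbove j).trans_lt hc)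
    choose x hx using hlt
    have hbdd : BddBelow (Set.range fun x : (j : ι) → X j => ⨆ j, F j (x j)) := by
      obtain ⟨j⟩ := ‹Nonempty ι›
      obtain ⟨b, hb⟩ := hF j
      refine ⟨b, ?_⟩
      rintro _ ⟨x, rfl⟩
      exact (hb ⟨x j, rfl⟩).trans
        (le_ciSup (f := fun j => F j (x j)) (Set.finite_range _).bddAbove j)
    exact (ciInf_le hbdd x).trans (ciSup_le fun j => (hx j).le)
  · exact ciSup_le fun j => le_ciInf fun x => (ciInf_le (hF j) (x j)).trans
      (le_ciSup (f := fun j => F j (x j)) (Set.finite_range _).bddAbove j)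

theorem iSup_eq_iSup_fiber {I ι α : Type*} [Finite I] [Nonempty I] [Finite ι] [Nonempty ι]
    [ConditionallyCompleteLinearOrder α] {blk : I → ι} (hblk : Function.Surjective blk)
    {X : ι → Type*} (f : (i : I) → X (blk i) → α) (x : (j : ι) → X j) :
    (⨆ i, f i (x (blk i))) =
      ⨆ j, ⨆ i : {i : I // blk i = j}, f i.1 (i.2.symm ▸ x j) := by
  apply le_antisymm
  · refine ciSup_le fun i => ?_
    exact (le_ciSup (f := fun k : {k : I // blk k = blk i} => f k.1 (k.2.symm ▸ x (blk i)))
      (Set.finite_range _).bddAbove ⟨i, rfl⟩).trans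
      (le_ciSup (f := fun j => ⨆ i : {i : I // blk i = j}, f i.1 (i.2.symm ▸ x j))
        (Set.finite_range _).bddAbove (blk i))
  · refine ciSup_le fun j => ?_
    obtain ⟨i₀, hi₀⟩ := hblk j
    have : Nonempty {i : I // blk i = j} := ⟨⟨i₀, hi₀⟩⟩
    refine ciSup_le ?_
    rintro ⟨i, rfl⟩
    exact le_ciSup (f := fun i => f i (x (blk i))) (Set.finite_range _).bddAbove i

/-- Decoupling under block-separable parameterization: when each task's loss depends
only on the parameter block its index is routed to, the globally optimal worst-case
error equals the maximum of the blockwise optimal worst-case errors. -/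
theorem block_separable_decoupling {I : Type*} [Fintype I] [Nonempty I]
    (L : ℕ) (hL : 1 ≤ L)
    (blk : I → Fin L) (hblk : Function.Surjective blk)
    (X : Fin L → Type*) [∀ j, Nonempty (X j)]
    (f : (i : I) → X (blk i) → ℝ) (hf : ∀ i x, 0 ≤ f i x) :
    (⨅ x : (j : Fin L) → X j, ⨆ i : I, f i (x (blk i))) =
      ⨆ j : Fin L, ⨅ xj : X j, ⨆ i : {i : I // blk i = j}, f i.1 (i.2.symm ▸ xj) := by
  have : Nonempty (Fin L) := ⟨⟨0, hL⟩⟩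
  simp_rw [iSup_eq_iSup_fiber hblk f]
  refine iInf_pi_iSup_eq_iSup_iInf
    (fun j (y : X j) => ⨆ i : {i : I // blk i = j}, f i.1 (i.2.symm ▸ y)) fun j => ⟨0, ?_⟩
  rintro _ ⟨y, rfl⟩
  exact Real.iSup_nonneg fun i => hf _ _
end

section
/- Let S and A be nonempty finite sets, P : S → A → S → ℝ with P s a s' ≥ 0 and ∑_{s'} P s a s' = 1 for all (s,a), γ ∈ [0,1), and r : S → A → ℝ. Then the Bellman optimality operator (T Q)(s,a) := r(s,a) + γ·∑_{s'} P s a s'·max_{a'} Q(s',a') has a unique fixed point Q* : S → A → ℝ, and this fixed point satisfies ‖Q*‖∞ ≤ ‖r‖∞/(1−γ). -/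
open scoped BigOperators

/-- The supremum over a finite type is `1`-Lipschitz for the sup distance. -/
lemma abs_ciSup_sub_ciSup_le {ι : Type*} [Finite ι] [Nonempty ι] {f g : ι → ℝ} {c : ℝ}
    (h : ∀ i, |f i - g i| ≤ c) : |(⨆ i, f i) - ⨆ i, g i| ≤ c := by
  rw [abs_sub_le_iff, sub_le_iff_le_add, sub_le_iff_le_add]
  constructor
  · refine ciSup_le fun i => ?_
    linarith [(abs_sub_le_iff.1 (h i)).1, le_ciSup (Set.finite_range g).bddAbove i]
  · refine ciSup_le fun i => ?_
    linarith [(abs_sub_le_iff.1 (h i)).2, le_ciSup (Set.finite_range f).bddAbove i]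

/-- Averaging against a probability vector is `1`-Lipschitz for the sup distance. -/
lemma abs_sum_mul_sub_sum_mul_le {ι : Type*} [Fintype ι] {p f g : ι → ℝ} {c : ℝ}
    (hp : ∀ i, 0 ≤ p i) (hp1 : ∑ i, p i = 1) (h : ∀ i, |f i - g i| ≤ c) :
    |∑ i, p i * f i - ∑ i, p i * g i| ≤ c := by
  calc |∑ i, p i * f i - ∑ i, p i * g i| = |∑ i, p i * (f i - g i)| := by
        simp only [mul_sub, Finset.sum_sub_distrib]
    _ ≤ ∑ i, |p i * (f i - g i)| := Finset.abs_sum_le_sum_abs _ _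
    _ ≤ ∑ i, p i * c := Finset.sum_le_sum fun i _ => by
        rw [abs_mul, abs_of_nonneg (hp i)]
        exact mul_le_mul_of_nonneg_left (h i) (hp i)
    _ = c := by rw [← Finset.sum_mul, hp1, one_mul]

lemma abs_apply_apply_le_norm {S A : Type*} [Fintype S] [Fintype A] (Q : S → A → ℝ)
    (s : S) (a : A) : |Q s a| ≤ ‖Q‖ :=
  (norm_le_pi_norm (Q s) a).trans (norm_le_pi_norm Q s)

/-- The iterated product norm is the maximum of the absolute values of the entries. -/
lemma norm_eq_ciSup_abs {S A : Type*} [Fintype S] [Fintype A] [Nonempty S] [Nonempty A]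
    (Q : S → A → ℝ) : ‖Q‖ = ⨆ p : S × A, |Q p.1 p.2| := by
  refine le_antisymm ?_ (ciSup_le fun p => abs_apply_apply_le_norm Q p.1 p.2)
  have h (p : S × A) : |Q p.1 p.2| ≤ ⨆ p : S × A, |Q p.1 p.2| :=
    le_ciSup (f := fun p : S × A => |Q p.1 p.2|) (Set.finite_range _).bddAbove p
  exact (pi_norm_le_iff_of_nonempty _).2 fun s =>
    (pi_norm_le_iff_of_nonempty _).2 fun a => h (s, a)

/-- The Bellman optimality operator of a finite MDP has a unique fixed point `Q*`,
and every fixed point satisfies `‖Q*‖∞ ≤ ‖r‖∞ / (1 - γ)`. -/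
theorem bellman_optimality_fixed_point
    {S A : Type*} [Fintype S] [Fintype A] [Nonempty S] [Nonempty A]
    (P : S → A → S → ℝ) (hP0 : ∀ s a s', 0 ≤ P s a s')
    (hP1 : ∀ s a, ∑ s' : S, P s a s' = 1)
    (γ : ℝ) (hγ0 : 0 ≤ γ) (hγ1 : γ < 1)
    (r : S → A → ℝ)
    (T : (S → A → ℝ) → S → A → ℝ)
    (hT : ∀ Q s a, T Q s a = r s a + γ * ∑ s' : S, P s a s' * ⨆ a' : A, Q s' a') :
    (∃! Q : S → A → ℝ, T Q = Q) ∧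
      ∀ Q : S → A → ℝ, T Q = Q →
        (⨆ p : S × A, |Q p.1 p.2|) ≤ (⨆ p : S × A, |r p.1 p.2|) / (1 - γ) := by
  have hlip (Q R : S → A → ℝ) : ‖T Q - T R‖ ≤ γ * ‖Q - R‖ := by
    refine (pi_norm_le_iff_of_nonempty _).2 fun s => (pi_norm_le_iff_of_nonempty _).2 fun a => ?_
    rw [Pi.sub_apply, Pi.sub_apply, hT, hT, add_sub_add_left_eq_sub, ← mul_sub, Real.norm_eq_abs,
      abs_mul, abs_of_nonneg hγ0]
    exact mul_le_mul_of_nonneg_left (abs_sum_mul_sub_sum_mul_le (hP0 s a) (hP1 s a) fun s' =>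
      abs_ciSup_sub_ciSup_le fun a' => abs_apply_apply_le_norm (Q - R) s' a') hγ0
  have hcontr : ContractingWith ⟨γ, hγ0⟩ T :=
    ⟨hγ1, LipschitzWith.of_dist_le_mul fun Q R => by
      rw [dist_eq_norm, dist_eq_norm]
      exact hlip Q R⟩
  refine ⟨⟨hcontr.fixedPoint T, hcontr.fixedPoint_isFixedPt,
    fun Q hQ => hcontr.fixedPoint_unique hQ⟩, fun Q hQ => ?_⟩
  have hT0 : T 0 = r := by
    ext s a
    simp [hT]
  have hQr : ‖Q - r‖ ≤ γ * ‖Q‖ := by simpa [hQ, hT0] using hlip Q 0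
  rw [← norm_eq_ciSup_abs, ← norm_eq_ciSup_abs, le_div_iff₀ (sub_pos.2 hγ1)]
  linarith [norm_sub_norm_le Q r]
end

section
/- Let S and A be nonempty finite sets, P : S → A → S → ℝ with P s a s' ≥ 0 and ∑_{s'} P s a s' = 1 for all (s,a), γ ∈ [0,1), and r : S → A → ℝ. Let Q* be the unique fixed point of the Bellman optimality operator T and, for a deterministic policy π : S → A, let Q^π be the unique fixed point of the policy evaluation operator T_π. Suppose Q̂ : S → A → ℝ satisfies ‖Q̂ − Q*‖∞ ≤ δ and π is greedy with respect to Q̂, i.e. Q̂(s, π(s)) = max_a Q̂(s,a) for all s. Then Q*(s,a) − Q^π(s,a) ≤ 2γδ/(1−γ) for all (s,a). -/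
open scoped BigOperators

/-- A convex combination of numbers that are at most `c` is at most `c`. -/
theorem sum_mul_le_of_forall_le {ι : Type*} [Fintype ι] {w f : ι → ℝ} {c : ℝ}
    (hw0 : ∀ i, 0 ≤ w i) (hw1 : ∑ i, w i = 1) (hf : ∀ i, f i ≤ c) :
    ∑ i, w i * f i ≤ c :=
  calc ∑ i, w i * f i ≤ ∑ i, w i * c :=
        Finset.sum_le_sum fun i _ => mul_le_mul_of_nonneg_left (hf i) (hw0 i)
    _ = c := by rw [← Finset.sum_mul, hw1, one_mul]

/-- If `a₀` maximizes `f` and `g` is within `δ` of `f`, then `a₀` is `2δ`-optimal for `g`. -/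
theorem ciSup_le_add_of_abs_sub_le {A : Type*} [Finite A] [Nonempty A] {f g : A → ℝ} {δ : ℝ}
    {a₀ : A} (hfg : ∀ a, |f a - g a| ≤ δ) (ha₀ : f a₀ = ⨆ a, f a) :
    ⨆ a, g a ≤ g a₀ + 2 * δ := by
  refine ciSup_le fun a => ?_
  have hmax : f a ≤ f a₀ := ha₀ ▸ le_ciSup (Set.finite_range f).bddAbove a
  linarith [(abs_le.mp (hfg a)).1, (abs_le.mp (hfg a₀)).2]

/-- Greedy-policy suboptimality bound: if `Q̂` is `δ`-close to `Q*` in sup norm and `π`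
is greedy with respect to `Q̂`, then `Q* - Q^π ≤ 2γδ/(1-γ)` pointwise. -/
theorem greedy_policy_suboptimality
    {S A : Type*} [Fintype S] [Fintype A] [Nonempty S] [Nonempty A]
    (P : S → A → S → ℝ) (hP0 : ∀ s a s', 0 ≤ P s a s')
    (hP1 : ∀ s a, ∑ s' : S, P s a s' = 1)
    (γ : ℝ) (hγ0 : 0 ≤ γ) (hγ1 : γ < 1)
    (r : S → A → ℝ) (π : S → A)
    (Qstar : S → A → ℝ)
    (hQstar : ∀ s a, Qstar s a = r s a + γ * ∑ s' : S, P s a s' * ⨆ a' : A, Qstar s' a')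
    (Qpi : S → A → ℝ)
    (hQpi : ∀ s a, Qpi s a = r s a + γ * ∑ s' : S, P s a s' * Qpi s' (π s'))
    (Qhat : S → A → ℝ) (δ : ℝ)
    (hδ : (⨆ p : S × A, |Qhat p.1 p.2 - Qstar p.1 p.2|) ≤ δ)
    (hπ : ∀ s, Qhat s (π s) = ⨆ a : A, Qhat s a) :
    ∀ s a, Qstar s a - Qpi s a ≤ 2 * γ * δ / (1 - γ) := by
  have hclose : ∀ s a, |Qhat s a - Qstar s a| ≤ δ := fun s a =>
    (le_ciSup (f := fun p : S × A => |Qhat p.1 p.2 - Qstar p.1 p.2|)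
      (Set.finite_range _).bddAbove (s, a)).trans hδ
  obtain ⟨⟨s₀, a₀⟩, hmax⟩ := Finite.exists_max fun p : S × A => Qstar p.1 p.2 - Qpi p.1 p.2
  have hstep : Qstar s₀ a₀ - Qpi s₀ a₀ ≤ γ * (2 * δ + (Qstar s₀ a₀ - Qpi s₀ a₀)) := by
    have hsum : Qstar s₀ a₀ - Qpi s₀ a₀ =
        γ * ∑ s', P s₀ a₀ s' * ((⨆ a', Qstar s' a') - Qpi s' (π s')) := by
      simp only [mul_sub, Finset.sum_sub_distrib]
      rw [hQstar s₀ a₀, hQpi s₀ a₀]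
      ring
    refine hsum.trans_le (mul_le_mul_of_nonneg_left ?_ hγ0)
    refine sum_mul_le_of_forall_le (hP0 s₀ a₀) (hP1 s₀ a₀) fun s' => ?_
    linarith [ciSup_le_add_of_abs_sub_le (hclose s') (hπ s'), hmax (s', π s')]
  intro s a
  refine (hmax (s, a)).trans ?_
  rw [le_div_iff₀ (sub_pos.mpr hγ1)]
  linarith
end
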